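/- arXiv:0904.0580 — 2 statements merged into one kernel-verified Lean document; each statement's English description precedes it below -/
import Mathlib

section
/- Let R be a nonnegative random variable whose distribution function H has infinite upper endpoint and is in the max-domain of attraction of the Gumbel law with positive auxiliary function ψ (i.e. lim_{x→∞}(1−H(x+ψ(x)t))/(1−H(x)) = e^{−t} for all t∈ℝ). Let V be a bounded random variable, independent of R, whose essential supremum v* is finite and strictly positive, and set Y = R·V. Let b and b_Y denote the generalized inverse functions of t ↦ 1/P(R > t) and t ↦ 1/P(Y > t), respectively. Then b_Y(t) ∼ v*·b(t) as t → ∞. -/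
open MeasureTheory ProbabilityTheory Filter Set

noncomputable def survival {Ω : Type*} [MeasurableSpace Ω] (P : Measure Ω) (Z : Ω → ℝ) (x : ℝ) : ℝ :=
  (P {ω | Z ω > x}).toReal

/-- The survival function `S` is `Γ`-varying with auxiliary function `ψ`. -/
def GumbelMDA (S : ℝ → ℝ) (ψ : ℝ → ℝ) : Prop :=
  ∀ t : ℝ, Tendsto (fun x => S (x + ψ x * t) / S x) atTop (nhds (Real.exp (-t)))

/-- Generalized inverse of `t ↦ 1/P(Z > t)`. -/
noncomputable def genInv {Ω : Type*} [MeasurableSpace Ω] (P : Measure Ω) (Z : Ω → ℝ) (t : ℝ) : ℝ :=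
  sInf {x | t ≤ 1 / survival P Z x}

section aux
variable {Ω : Type*} [MeasurableSpace Ω] (P : Measure Ω) [IsProbabilityMeasure P]

theorem surv_anti (Z : Ω → ℝ) : Antitone (survival P Z) := by
  intro x y hxy
  unfold survival
  refine ENNReal.toReal_mono (measure_ne_top _ _) (measure_mono ?_)
  intro ω (h : Z ω > y)
  exact lt_of_le_of_lt hxy h

theorem surv_tendsto (Z : Ω → ℝ) (hZ : Measurable Z) : Tendsto (survival P Z) atTop (nhds 0) := by
  haveI : IsProbabilityMeasure (P.map Z) := Measure.isProbabilityMeasure_map hZ.aemeasurable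
  have h := (tendsto_cdf_atTop (P.map Z)).const_sub 1
  rw [sub_self] at h
  refine h.congr fun x => ?_
  have h1 : survival P Z x = (P.map Z).real (Iic x)ᶜ := by
    unfold survival Measure.real
    rw [Measure.map_apply hZ measurableSet_Iic.compl]
    congr 2
    ext ω
    simp
  rw [h1, probReal_compl_eq_one_sub measurableSet_Iic, cdf_eq_real]

theorem rapid (S ψ : ℝ → ℝ) (hS : Antitone S) (hpos : ∀ x, 0 < S x)
    (h0 : Tendsto S atTop (nhds 0)) (hg : GumbelMDA S ψ) (hψ : ∀ x, 0 < ψ x)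
    (c : ℝ) (hc : 1 < c) (q : ℝ) (hq : 0 < q) : ∀ᶠ x in atTop, S (c * x) ≤ q * S x := by
  -- choose t with exp (-t) < q, t > 0
  obtain ⟨t, ht0, htq⟩ : ∃ t : ℝ, 0 < t ∧ Real.exp (-t) < q := by
    have h := (Real.tendsto_exp_neg_atTop_nhds_zero).eventually (gt_mem_nhds hq)
    obtain ⟨t, h1, h2⟩ := (h.and (eventually_gt_atTop 0)).exists
    exact ⟨t, h2, h1⟩
  have hc1 : 0 < c - 1 := by linarith
  set A := t / (c - 1) with hA
  have e1 := (hg t).eventually (gt_mem_nhds htq)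
  have e2 : Tendsto (fun x => S (x + ψ x * (-A))) atTop (nhds 0) := by
    have h := (hg (-A)).mul h0
    rw [mul_zero] at h
    refine h.congr fun x => ?_
    exact div_mul_cancel₀ _ (hpos x).ne'
  have e3 := e2.eventually (gt_mem_nhds (hpos 0))
  filter_upwards [e1, e3] with x h1 h3
  have hx : 0 < x + ψ x * (-A) := by
    by_contra! h
    exact absurd (hS h) (not_le.mpr h3)
  have hle : x + ψ x * t ≤ c * x := by
    have : t = A * (c - 1) := by rw [hA]; field_simp
    rw [this]
    nlinarith
  rw [div_lt_iff₀ (hpos x)] at h1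
  exact (hS hle).trans h1.le

end aux

/-- Equation (12): `b_Y(t) ∼ v* b(t)` for `Y = R·V` with `V` bounded of essential
supremum `v* > 0` and `R` in the Gumbel max-domain of attraction. -/
theorem genInv_product_asymptotic {Ω : Type*} [MeasurableSpace Ω] (P : Measure Ω)
    [IsProbabilityMeasure P]
    (R V : Ω → ℝ) (hR : Measurable R) (hV : Measurable V)
    (hRnonneg : ∀ᵐ ω ∂P, 0 ≤ R ω)
    (hsurv : ∀ x, 0 < survival P R x)
    (ψ : ℝ → ℝ) (hψpos : ∀ x, 0 < ψ x)
    (hgum : GumbelMDA (survival P R) ψ)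
    (hindep : IndepFun R V P)
    -- `V` is bounded:
    (M : ℝ) (hbdd : ∀ᵐ ω ∂P, |V ω| ≤ M)
    -- `vstar` is the essential supremum of `V`, finite and strictly positive:
    (vstar : ℝ) (hvpos : 0 < vstar)
    (hub : ∀ᵐ ω ∂P, V ω ≤ vstar)
    (hlub : ∀ c : ℝ, (∀ᵐ ω ∂P, V ω ≤ c) → vstar ≤ c)
    (Y : Ω → ℝ) (hY : Y = fun ω => R ω * V ω) :
    Tendsto (fun t => genInv P Y t / (vstar * genInv P R t)) atTop (nhds 1) := by
  have hanti := surv_anti P R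
  have hlim := surv_tendsto P R hR
  have hvq : ∀ v < vstar, 0 < (P {ω | V ω > v}).toReal := by
    intro v hv
    refine ENNReal.toReal_pos ?_ (measure_ne_top _ _)
    intro h0
    have : ∀ᵐ ω ∂P, V ω ≤ v := by
      rw [ae_iff]
      simpa using h0
    exact absurd (hlub v this) (not_le.mpr hv)
  have hlow : ∀ v, 0 < v → ∀ x, 0 ≤ x →
      (P {ω | V ω > v}).toReal * survival P R x ≤ survival P Y (v * x) := by
    intro v hv x hx
    have hi := hindep.measure_inter_preimage_eq_mul (Ioi x) (Ioi v) measurableSet_Ioi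
      measurableSet_Ioi
    unfold survival
    rw [mul_comm, ← ENNReal.toReal_mul]
    refine ENNReal.toReal_mono (measure_ne_top _ _) ?_
    refine (le_of_eq hi.symm).trans (measure_mono ?_)
    rintro ω ⟨h1, h2⟩
    have h1' : x < R ω := h1
    have h2' : v < V ω := h2
    simp only [hY, mem_setOf_eq]
    nlinarith
  have hup : ∀ x, survival P Y (vstar * x) ≤ survival P R x := by
    intro x
    unfold survival
    refine ENNReal.toReal_mono (measure_ne_top _ _) (measure_mono_ae ?_)
    filter_upwards [hRnonneg, hub] with ω h1 h2 h3
    have h3' : vstar * x < Y ω := h3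
    rw [hY] at h3'
    change x < R ω
    have : R ω * V ω ≤ R ω * vstar := mul_le_mul_of_nonneg_left h2 h1
    have h4 : vstar * x < vstar * R ω := by linarith
    exact lt_of_mul_lt_mul_left h4 hvpos.le
  have hantiY := surv_anti P Y
  have hYpos : ∀ y, 0 < survival P Y y := by
    intro y
    have hv2 : 0 < vstar / 2 := by linarith
    have h1 := hlow (vstar / 2) hv2 (|y| / (vstar / 2)) (by positivity)
    rw [mul_div_cancel₀ _ hv2.ne'] at h1
    have h2 := mul_pos (hvq (vstar / 2) (by linarith)) (hsurv (|y| / (vstar / 2)))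
    exact (h2.trans_le h1).trans_le (hantiY (le_abs_self y))
  -- lower bounds for the level sets
  have hlbR : ∀ a t, 1 / survival P R a < t → ∀ x, t ≤ 1 / survival P R x → a < x := by
    intro a t ht x hx
    by_contra! h
    have := one_div_le_one_div_of_le (hsurv a) (hanti h)
    linarith
  have hlbY : ∀ a t, 1 / survival P Y a < t → ∀ x, t ≤ 1 / survival P Y x → a < x := by
    intro a t ht x hx
    by_contra! h
    have := one_div_le_one_div_of_le (hYpos a) (hantiY h)
    linarith
  have hneR : ∀ t, 0 < t → {x | t ≤ 1 / survival P R x}.Nonempty := by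
    intro t ht
    obtain ⟨x, hx⟩ := (hlim.eventually (gt_mem_nhds (one_div_pos.mpr ht))).exists
    refine ⟨x, ?_⟩
    exact (le_one_div ht (hsurv x)).mpr hx.le
  have hsub : ∀ t x, t ≤ 1 / survival P R x → t ≤ 1 / survival P Y (vstar * x) := by
    intro t x hx
    exact hx.trans (one_div_le_one_div_of_le (hYpos _) (hup x))
  have hmain : ∀ c : ℝ, 1 < c → ∀ᶠ t in atTop, 0 < genInv P R t ∧
      genInv P Y t ≤ vstar * genInv P R t ∧ vstar * genInv P R t ≤ c ^ 2 * genInv P Y t := by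
    intro c hc
    have hc0 : 0 < c := by linarith
    have hvc : vstar / c < vstar := div_lt_self hvpos hc
    have hvc0 : 0 < vstar / c := by positivity
    obtain ⟨x1, hx1⟩ := eventually_atTop.mp
      (rapid _ ψ hanti hsurv hlim hgum hψpos c hc _ (hvq _ hvc))
    set x0 := max x1 0 with hx0
    filter_upwards [eventually_gt_atTop 0, eventually_gt_atTop (1 / survival P R 1),
      eventually_gt_atTop (1 / survival P Y (vstar / c * x0))] with t ht0 htR htY
    have hbR : BddBelow {x | t ≤ 1 / survival P R x} :=
      ⟨1, fun x hx => (hlbR 1 t htR x hx).le⟩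
    have hbY : BddBelow {x | t ≤ 1 / survival P Y x} :=
      ⟨_, fun x hx => (hlbY _ t htY x hx).le⟩
    have hneY : {x | t ≤ 1 / survival P Y x}.Nonempty := by
      obtain ⟨x, hx⟩ := hneR t ht0
      exact ⟨_, hsub t x hx⟩
    refine ⟨?_, ?_, ?_⟩
    · have : 1 ≤ genInv P R t := le_csInf (hneR t ht0) fun x hx => (hlbR 1 t htR x hx).le
      linarith
    · rw [← div_le_iff₀' hvpos]
      refine le_csInf (hneR t ht0) fun x hx => ?_
      rw [div_le_iff₀' hvpos]
      exact csInf_le hbY (hsub t x hx)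
    · rw [← div_le_iff₀' (by positivity : 0 < c ^ 2)]
      refine le_csInf hneY fun z hz => ?_
      have hz' := hlbY _ t htY z hz
      rw [div_le_iff₀' (by positivity : 0 < c ^ 2), ← le_div_iff₀' hvpos]
      refine csInf_le hbR ?_
      have hzx : x0 < z / (vstar / c) := by
        rw [lt_div_iff₀' hvc0]; exact hz'
      have h1 := hx1 _ ((le_max_left x1 0).trans hzx.le)
      have h2 := hlow _ hvc0 _ ((le_max_right x1 0).trans hzx.le)
      rw [mul_div_cancel₀ _ hvc0.ne'] at h2
      have h3 : c * (z / (vstar / c)) = c ^ 2 * z / vstar := by field_simp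
      rw [h3] at h1
      exact le_trans hz (one_div_le_one_div_of_le (hsurv _) (h1.trans h2))
  rw [tendsto_order]
  constructor
  · intro a ha
    obtain ⟨c, hc, hca⟩ : ∃ c : ℝ, 1 < c ∧ a * c ^ 2 < 1 := by
      have h : Tendsto (fun c : ℝ => a * c ^ 2) (nhdsWithin 1 (Ioi 1)) (nhds (a * 1 ^ 2)) :=
        ((by fun_prop : Continuous fun c : ℝ => a * c ^ 2).tendsto 1).mono_left nhdsWithin_le_nhds
      have h2 := h.eventually (gt_mem_nhds (by simpa using ha : a * 1 ^ 2 < 1))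
      obtain ⟨c, h3, h4⟩ := (h2.and self_mem_nhdsWithin).exists
      exact ⟨c, h4, h3⟩
    filter_upwards [hmain c hc] with t ⟨h1, h2, h3⟩
    have hb : 0 < vstar * genInv P R t := mul_pos hvpos h1
    rw [lt_div_iff₀ hb]
    have hc2 : 0 < c ^ 2 := by positivity
    have h5 : a * c ^ 2 * (vstar * genInv P R t) < c ^ 2 * genInv P Y t := by
      nlinarith
    refine lt_of_mul_lt_mul_left (a := c ^ 2) ?_ hc2.le
    linarith
  · intro a ha
    filter_upwards [hmain 2 (by norm_num)] with t ⟨h1, h2, h3⟩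
    have hb : 0 < vstar * genInv P R t := mul_pos hvpos h1
    exact lt_of_le_of_lt ((div_le_one hb).mpr h2) ha
end

section
/- Let H be a distribution function with infinite right endpoint that is in the max-domain of attraction of the Gumbel law with positive auxiliary function ψ; write H̄ = 1−H. Then for any p > 0 and any α > 1, there exists a constant C such that for all x large enough: (a) H̄(x + ψ(x)t)/H̄(x) ≤ C(1+t)^{−p} for all t ≥ 0, and (b) H̄(αx)/H̄(x) ≤ C(ψ(x)/x)^p. -/
open Filter Set

/-- Lemma 1: bounds on the survival ratios of a distribution function in the Gumbel
max-domain of attraction with infinite right endpoint. -/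
theorem gumbel_survival_bounds (H : ℝ → ℝ)
    -- `H` is a distribution function with infinite right endpoint:
    (hmono : Monotone H) (hnonneg : ∀ x, 0 ≤ H x) (hlt : ∀ x, H x < 1)
    (hlim : Tendsto H atTop (nhds 1))
    -- in the Gumbel max-domain of attraction with positive auxiliary function `ψ`:
    (ψ : ℝ → ℝ) (hψpos : ∀ x, 0 < ψ x)
    (hgum : ∀ t : ℝ, Tendsto (fun x => (1 - H (x + ψ x * t)) / (1 - H x)) atTop
      (nhds (Real.exp (-t)))) :
    ∀ p : ℝ, 0 < p → ∀ α : ℝ, 1 < α → ∃ C : ℝ, ∃ x₀ : ℝ, ∀ x : ℝ, x₀ ≤ x →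
      (∀ t : ℝ, 0 ≤ t → (1 - H (x + ψ x * t)) / (1 - H x) ≤ C * (1 + t) ^ (-p)) ∧
      (1 - H (α * x)) / (1 - H x) ≤ C * (ψ x / x) ^ p := by
  intro p hp α hα
  obtain ⟨G, hG⟩ : ∃ G : ℝ → ℝ, ∀ x, G x = 1 - H x := ⟨_, fun _ => rfl⟩
  simp only [← hG] at hgum ⊢
  have hGpos : ∀ x, 0 < G x := fun x => by rw [hG]; linarith [hlt x]
  have hGanti : ∀ x y, x ≤ y → G y ≤ G x := fun x y h => by
    rw [hG, hG]; linarith [hmono h]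
  obtain ⟨r, hr⟩ : ∃ r : ℝ, r = Real.exp (1 / (2 * p)) := ⟨_, rfl⟩
  obtain ⟨q, hq⟩ : ∃ q : ℝ, q = Real.exp (-(1 / 2)) := ⟨_, rfl⟩
  have hr1 : 1 < r := by rw [hr]; exact Real.one_lt_exp_iff.mpr (by positivity)
  have hr0 : 0 < r := by linarith
  have hq0 : 0 < q := by rw [hq]; positivity
  have hrp : r ^ (-p) = q := by
    rw [hr, hq, ← Real.exp_mul]; congr 1; field_simp
  have hy : Tendsto (fun x => x + ψ x) atTop atTop :=
    tendsto_atTop_mono (fun x => by simp only [id]; linarith [hψpos x]) tendsto_id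
  have h1 := hgum 1
  have h2 := (h1.comp hy).mul h1
  have h3 := hgum (1 + r)
  have hlt' : Real.exp (-(1 + r)) < Real.exp (-1) * Real.exp (-1) := by
    rw [← Real.exp_add]; exact Real.exp_lt_exp.mpr (by linarith)
  have e1 := h3.eventually_lt h2 hlt'
  have e2 := h1.eventually_lt_const (u := q)
    (by rw [hq]; exact Real.exp_lt_exp.mpr (by norm_num))
  obtain ⟨x₁, hx₁⟩ := eventually_atTop.mp (e1.and e2)
  have hψ : ∀ x, x₁ ≤ x → ψ (x + ψ x) ≤ r * ψ x := by
    intro x hx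
    have h := (hx₁ x hx).1
    by_contra hc
    push Not at hc
    simp only [Function.comp, mul_one] at h
    rw [div_mul_div_cancel₀ (hGpos _).ne', div_lt_div_iff_of_pos_right (hGpos x)] at h
    exact absurd h (not_lt.mpr (hGanti _ _ (by nlinarith)))
  have hGq : ∀ x, x₁ ≤ x → G (x + ψ x) ≤ q * G x := by
    intro x hx
    have h := (hx₁ x hx).2
    rw [mul_one, div_lt_iff₀ (hGpos x)] at h
    exact h.le
  have key : ∀ n : ℕ, ∀ x, x₁ ≤ x →
      G (x + ψ x * ((r ^ n - 1) / (r - 1))) ≤ q ^ n * G x := by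
    intro n
    induction n with
    | zero => intro x hx; simp
    | succ n ih =>
      intro x hx
      have hx' : x₁ ≤ x + ψ x := by linarith [hψpos x]
      have hS : 0 ≤ (r ^ n - 1) / (r - 1) :=
        div_nonneg (by linarith [one_le_pow₀ hr1.le (n := n)]) (by linarith)
      have hS' : (r ^ (n + 1) - 1) / (r - 1) = 1 + r * ((r ^ n - 1) / (r - 1)) := by
        have : r - 1 ≠ 0 := by linarith
        field_simp; ring
      calc G (x + ψ x * ((r ^ (n + 1) - 1) / (r - 1)))
          ≤ G (x + ψ x + ψ (x + ψ x) * ((r ^ n - 1) / (r - 1))) := by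
            apply hGanti
            rw [hS']
            nlinarith [mul_le_mul_of_nonneg_right (hψ x hx) hS]
        _ ≤ q ^ n * G (x + ψ x) := ih _ hx'
        _ ≤ q ^ n * (q * G x) := by gcongr; exact hGq x hx
        _ = q ^ (n + 1) * G x := by ring
  obtain ⟨c, hc⟩ : ∃ c : ℝ, c = min 1 (r - 1) := ⟨_, rfl⟩
  have hc0 : 0 < c := by rw [hc]; exact lt_min one_pos (by linarith)
  have hc1 : c ≤ 1 := by rw [hc]; exact min_le_left _ _
  have hc2 : c ≤ r - 1 := by rw [hc]; exact min_le_right _ _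
  obtain ⟨D, hD⟩ : ∃ D : ℝ, D = q⁻¹ * c ^ (-p) := ⟨_, rfl⟩
  have hD0 : 0 < D := by rw [hD]; positivity
  have hA : ∀ x, x₁ ≤ x → ∀ t : ℝ, 0 ≤ t →
      G (x + ψ x * t) / G x ≤ D * (1 + t) ^ (-p) := by
    intro x hx t ht
    have hr1' : 0 < r - 1 := by linarith
    obtain ⟨n, hn1, hn2⟩ := exists_nat_pow_near
      (show 1 ≤ 1 + (r - 1) * t by nlinarith) hr1
    rw [div_le_iff₀ (hGpos x)]
    have hle : (r ^ n - 1) / (r - 1) ≤ t := by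
      rw [div_le_iff₀ hr1']; linarith
    have hqn : q ^ (n + 1) ≤ c ^ (-p) * (1 + t) ^ (-p) := by
      rw [← hrp, ← Real.mul_rpow hc0.le (by linarith), ← Real.rpow_natCast,
        ← Real.rpow_mul hr0.le, mul_comm (-p), Real.rpow_mul hr0.le, Real.rpow_natCast]
      exact Real.rpow_le_rpow_of_nonpos (by positivity) (by nlinarith) (by linarith)
    calc G (x + ψ x * t) ≤ G (x + ψ x * ((r ^ n - 1) / (r - 1))) := by
            apply hGanti
            nlinarith [mul_le_mul_of_nonneg_left hle (hψpos x).le]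
      _ ≤ q ^ n * G x := key n x hx
      _ = q⁻¹ * q ^ (n + 1) * G x := by field_simp; ring
      _ ≤ q⁻¹ * (c ^ (-p) * (1 + t) ^ (-p)) * G x := by
            have := (hGpos x).le
            gcongr
      _ = D * (1 + t) ^ (-p) * G x := by rw [hD]; ring
  have hα' : 0 < α - 1 := by linarith
  have hE : 0 < (α - 1) ^ (-p) := by positivity
  refine ⟨D * (1 + (α - 1) ^ (-p)), max x₁ 1, fun x hx => ⟨fun t ht => ?_, ?_⟩⟩
  · refine (hA x (le_trans (le_max_left _ _) hx) t ht).trans ?_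
    have : 0 ≤ (1 + t) ^ (-p) := by positivity
    gcongr
    nlinarith
  · have hx0 : 0 < x := by linarith [le_max_right x₁ 1]
    have hψx := hψpos x
    have ht : 0 < (α - 1) * (x / ψ x) := by positivity
    have h := hA x (le_trans (le_max_left _ _) hx) _ ht.le
    have he : x + ψ x * ((α - 1) * (x / ψ x)) = α * x := by field_simp; ring
    rw [he] at h
    refine h.trans ?_
    have h4 : (1 + (α - 1) * (x / ψ x)) ^ (-p) ≤ ((α - 1) * (x / ψ x)) ^ (-p) :=
      Real.rpow_le_rpow_of_nonpos ht (by linarith) (by linarith)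
    have h5 : ((α - 1) * (x / ψ x)) ^ (-p) = (α - 1) ^ (-p) * (ψ x / x) ^ p := by
      rw [Real.mul_rpow hα'.le (by positivity), Real.rpow_neg (by positivity : 0 ≤ x / ψ x),
        ← Real.inv_rpow (by positivity), inv_div]
    have h6 : 0 < (ψ x / x) ^ p := by positivity
    calc D * (1 + (α - 1) * (x / ψ x)) ^ (-p) ≤ D * ((α - 1) ^ (-p) * (ψ x / x) ^ p) := by
            rw [← h5]; gcongr
      _ ≤ D * (1 + (α - 1) ^ (-p)) * (ψ x / x) ^ p := by
            nlinarith [mul_pos hD0 h6]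
end
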